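/- arXiv:2207.14810 — 2 statements merged into one kernel-verified Lean document; each statement's English description precedes it below -/
import Mathlib

section
/- There exists a constant c > 0 such that for every δ ∈ (0, 1) and every η ∈ (0, 1) there is a real polynomial P of degree at most ⌈c · (1/δ) · log(2/η)⌉ satisfying: (i) 0 ≤ P(x) ≤ η/2 for all x ∈ [-1, -δ]; (ii) 1 - η/2 ≤ P(x) ≤ 1 for all x ∈ [δ, 1]; and (iii) 0 ≤ P(x) ≤ 1 for all x ∈ [-1, 1]. -/
open Polynomial in
lemma exists_antideriv (Q : Polynomial ℝ) :
    ∃ F : Polynomial ℝ, derivative F = Q ∧ F.natDegree ≤ Q.natDegree + 1 := by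
  refine ⟨∑ i ∈ Finset.range (Q.natDegree + 1), monomial (i + 1) (Q.coeff i / (i + 1)), ?_, ?_⟩
  · conv_rhs => rw [Q.as_sum_range]
    rw [derivative_sum]
    refine Finset.sum_congr rfl fun i _ => ?_
    rw [derivative_monomial]
    have : (i : ℝ) + 1 ≠ 0 := by positivity
    simp [this]
  · refine natDegree_sum_le_of_forall_le _ _ fun i hi => ?_
    refine (natDegree_monomial_le _).trans ?_
    have := Finset.mem_range.1 hi
    omega

lemma cmp_deriv {f g f' g' : ℝ → ℝ} {a b : ℝ} (hab : a ≤ b)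
    (hf : ∀ x ∈ Set.Icc a b, HasDerivAt f (f' x) x)
    (hg : ∀ x ∈ Set.Icc a b, HasDerivAt g (g' x) x)
    (h : ∀ x ∈ Set.Ioo a b, f' x ≤ g' x) : f b - f a ≤ g b - g a := by
  have hm : MonotoneOn (fun x => g x - f x) (Set.Icc a b) := by
    refine monotoneOn_of_deriv_nonneg (convex_Icc a b) ?_ ?_ ?_
    · intro x hx
      exact ((hg x hx).sub (hf x hx)).continuousAt.continuousWithinAt
    · intro x hx
      have hx' := interior_subset hx
      exact ((hg x hx').sub (hf x hx')).differentiableAt.differentiableWithinAt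
    · intro x hx
      have hx' := interior_subset hx
      rw [interior_Icc] at hx
      have e : deriv (fun x => g x - f x) x = g' x - f' x :=
        ((hg x hx').sub (hf x hx')).deriv
      rw [e]
      linarith [h x hx]
  have := hm (Set.left_mem_Icc.2 hab) (Set.right_mem_Icc.2 hab) hab
  simp only at this
  linarith

open Polynomial in
lemma exists_kernel (j : ℕ) :
    ∃ R : Polynomial ℝ, R.natDegree ≤ 4 * j ∧
      (∀ x : ℝ, |x| ≤ 1 → |x| * |R.eval x| ≤ 1) ∧
      (∀ x : ℝ, 0 < x → x ≤ 1 / (4 * j + 1) → (4 * j + 1) / 2 ≤ R.eval x) := by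
  have key : ∀ φ : ℝ, (Chebyshev.T ℝ (4 * j + 1 : ℤ)).eval (Real.sin φ)
      = Real.sin ((4 * j + 1) * φ) := by
    intro φ
    rw [← Real.cos_pi_div_two_sub, Chebyshev.T_real_cos, ← Real.cos_pi_div_two_sub]
    push_cast
    rw [show (4 * (j : ℝ) + 1) * (Real.pi / 2 - φ)
      = (Real.pi / 2 - (4 * j + 1) * φ) + j * (2 * Real.pi) by ring]
    exact Real.cos_add_nat_mul_two_pi _ _
  have h0 : (Chebyshev.T ℝ (4 * j + 1 : ℤ)).eval 0 = 0 := by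
    simpa using key 0
  obtain ⟨R, hR⟩ := (dvd_iff_isRoot (p := Chebyshev.T ℝ (4 * j + 1 : ℤ)) (a := 0)).2 h0
  rw [C_0, sub_zero] at hR
  have hev : ∀ x : ℝ, (Chebyshev.T ℝ (4 * j + 1 : ℤ)).eval x = x * R.eval x := by
    intro x; rw [hR]; simp
  refine ⟨R, ?_, ?_, ?_⟩
  · by_cases hz : R = 0
    · simp [hz]
    have h1 : (Chebyshev.T ℝ (4 * j + 1 : ℤ)).natDegree = R.natDegree + 1 := by
      rw [hR, natDegree_X_mul hz]
    rw [Chebyshev.natDegree_T] at h1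
    omega
  · intro x hx
    rw [← abs_mul, ← hev]
    exact Chebyshev.abs_eval_T_real_le_one _ hx
  · intro x hx hx'
    set N : ℝ := 4 * j + 1 with hN
    have hN1 : (1 : ℝ) ≤ N := by
      have : (0 : ℝ) ≤ j := by positivity
      linarith
    have hNp : 0 < N := by linarith
    have hx1 : x ≤ 1 := hx'.trans (by rw [div_le_one hNp]; exact hN1)
    set φ := Real.arcsin x with hφ
    have hs : Real.sin φ = x := Real.sin_arcsin (by linarith) hx1
    have hφ0 : 0 ≤ φ := Real.arcsin_nonneg.2 hx.le
    have hφ1 : φ ≤ Real.pi / 2 := Real.arcsin_le_pi_div_two x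
    have hpi := Real.pi_pos
    have h1 := Real.mul_le_sin hφ0 hφ1
    have hxφ : x ≤ φ := hs ▸ Real.sin_le hφ0
    rw [hs] at h1
    have h2 : N * φ ≤ Real.pi / 2 := by
      have h3 : 2 / Real.pi * φ ≤ 1 / N := h1.trans hx'
      rw [le_div_iff₀ hNp] at h3
      have : 2 / Real.pi * φ * N = N * φ / (Real.pi / 2) := by field_simp
      rw [this, div_le_one (by positivity)] at h3
      exact h3
    have h3 := Real.mul_le_sin (by positivity : 0 ≤ N * φ) h2
    have h4 := key φ
    rw [hs, hev] at h4
    rw [← h4] at h3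
    have h5 : (1 : ℝ) / 2 ≤ 2 / Real.pi := by
      rw [div_le_div_iff₀ (by norm_num) hpi]
      linarith [Real.pi_le_four]
    have h6 : x * (N / 2) ≤ x * R.eval x := by
      calc x * (N / 2) = 1 / 2 * (N * x) := by ring
        _ ≤ 2 / Real.pi * (N * φ) := by gcongr
        _ ≤ _ := h3
    exact le_of_mul_le_mul_left h6 hx


set_option maxHeartbeats 1000000 in
/-- Polynomial approximation of the step function (Lin–Tong, Lemma 5):
for every `δ, η ∈ (0,1)` there is a polynomial of degree
`O((1/δ) log(2/η))` that is within `η/2` of `0` on `[-1, -δ]`, within `η/2`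
of `1` on `[δ, 1]`, and bounded between `0` and `1` on all of `[-1, 1]`. -/
theorem step_function_poly_approx :
    ∃ c : ℝ, 0 < c ∧
      ∀ δ η : ℝ, δ ∈ Set.Ioo (0 : ℝ) 1 → η ∈ Set.Ioo (0 : ℝ) 1 →
        ∃ P : Polynomial ℝ,
          P.natDegree ≤ ⌈c * (1 / δ) * Real.log (2 / η)⌉₊ ∧
          (∀ x ∈ Set.Icc (-1 : ℝ) (-δ), 0 ≤ P.eval x ∧ P.eval x ≤ η / 2) ∧
          (∀ x ∈ Set.Icc δ (1 : ℝ), 1 - η / 2 ≤ P.eval x ∧ P.eval x ≤ 1) ∧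
          (∀ x ∈ Set.Icc (-1 : ℝ) 1, 0 ≤ P.eval x ∧ P.eval x ≤ 1) := by
  refine ⟨100, by norm_num, ?_⟩
  rintro δ η ⟨hδ0, hδ1⟩ ⟨hη0, hη1⟩
  set L := Real.log (2 / η) with hL
  have hlog2 : 0.69 < Real.log 2 := by linarith [Real.log_two_gt_d9]
  have hL2 : Real.log 2 ≤ L := by
    apply Real.log_le_log (by norm_num)
    rw [le_div_iff₀ hη0]; linarith
  set j := ⌈1 / δ⌉₊ with hj
  set m := ⌈L / Real.log 2⌉₊ with hm
  have hj1 : 1 / δ ≤ j := Nat.le_ceil _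
  have hj2 : (j : ℝ) < 1 / δ + 1 := Nat.ceil_lt_add_one (by positivity)
  have hm1 : L / Real.log 2 ≤ m := Nat.le_ceil _
  have hm2 : (m : ℝ) < L / Real.log 2 + 1 :=
    Nat.ceil_lt_add_one (div_nonneg (by linarith) (by linarith))
  have hδi : 1 ≤ 1 / δ := by rw [le_div_iff₀ hδ0]; linarith
  have hpow : 2 / η ≤ (4 : ℝ) ^ m := by
    have h1 : L ≤ m * Real.log 2 := by
      rwa [div_le_iff₀ (by linarith)] at hm1
    have h2 : 2 / η ≤ (2 : ℝ) ^ m := by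
      rw [← Real.log_le_log_iff (by positivity) (by positivity), Real.log_pow]
      exact h1
    exact h2.trans (pow_le_pow_left₀ (by norm_num) (by norm_num) m)
  obtain ⟨R, hRd, hRu, hRl⟩ := exists_kernel j
  obtain ⟨F, hF, hFd⟩ := exists_antideriv (R ^ (2 * (m + 1)))
  have hder : ∀ x : ℝ, HasDerivAt (fun y => F.eval y) ((R.eval x) ^ (2 * (m + 1))) x := by
    intro x
    have := F.hasDerivAt x
    rwa [hF, Polynomial.eval_pow] at this
  have hQ0 : ∀ x : ℝ, 0 ≤ (R.eval x) ^ (2 * (m + 1)) := fun x =>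
    (even_two_mul _).pow_nonneg _
  have hmono : ∀ a b : ℝ, a ≤ b → F.eval a ≤ F.eval b := by
    intro a b hab
    have := cmp_deriv (f := fun _ => (0 : ℝ)) (f' := fun _ => 0) hab
      (fun x _ => hasDerivAt_const x 0) (fun x _ => hder x) (fun x _ => hQ0 x)
    linarith
  set D : ℝ := (1 / δ) ^ (2 * m) with hD
  have hD0 : 0 < D := by positivity
  -- pointwise tail bound
  have htail : ∀ x : ℝ, δ ≤ |x| → |x| ≤ 1 →
      (R.eval x) ^ (2 * (m + 1)) ≤ D * (x ^ 2)⁻¹ := by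
    intro x h1 h2
    have hx0 : 0 < |x| := by linarith
    have h3 : |R.eval x| ≤ 1 / |x| := by
      rw [le_div_iff₀ hx0, mul_comm]; exact hRu x h2
    have h4 : |R.eval x| ≤ 1 / δ := h3.trans (by gcongr)
    calc (R.eval x) ^ (2 * (m + 1)) = |R.eval x| ^ (2 * (m + 1)) := by
            rw [(even_two_mul _).pow_abs]
      _ = |R.eval x| ^ (2 * m) * |R.eval x| ^ 2 := by ring
      _ ≤ (1 / δ) ^ (2 * m) * (1 / |x|) ^ 2 := by gcongr
      _ = D * (x ^ 2)⁻¹ := by rw [div_pow 1 |x|, sq_abs, ← hD]; simp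
  have hdg : ∀ x : ℝ, x ≠ 0 → HasDerivAt (fun y : ℝ => D * -(y⁻¹)) (D * (x ^ 2)⁻¹) x := by
    intro x hx
    have := ((hasDerivAt_inv hx).neg).const_mul D
    simpa using this
  have hleft : F.eval (-δ) - F.eval (-1) ≤ D / δ := by
    have := cmp_deriv (a := -1) (b := -δ) (by linarith) (fun x _ => hder x)
      (fun x hx => hdg x (by linarith [hx.2] : x < 0).ne)
      (fun x hx => htail x (by rw [abs_of_neg (by linarith [hx.2])]; linarith [hx.2])
        (by rw [abs_of_neg (by linarith [hx.2])]; linarith [hx.1]))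
    have e : D * -(-δ)⁻¹ - D * -(-1)⁻¹ = D / δ - D := by
      field_simp
    rw [e] at this
    linarith
  have hright : F.eval 1 - F.eval δ ≤ D / δ := by
    have := cmp_deriv (a := δ) (b := 1) (by linarith) (fun x _ => hder x)
      (fun x hx => hdg x (by linarith [hx.1] : 0 < x).ne')
      (fun x hx => htail x (by rw [abs_of_pos (by linarith [hx.1])]; linarith [hx.1])
        (by rw [abs_of_pos (by linarith [hx.1])]; linarith [hx.2]))
    have e : D * -(1)⁻¹ - D * -(δ)⁻¹ = D / δ - D := by
      field_simp; ring
    rw [e] at this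
    linarith
  set N : ℝ := 4 * j + 1 with hN
  have hN4 : 4 * (1 / δ) ≤ N := by linarith
  have hNp : 0 < N := by linarith
  have hcenter : (N / 4) * (N / 2) ^ (2 * m) ≤ F.eval (1 / N) - F.eval 0 := by
    have := cmp_deriv (a := 0) (b := 1 / N) (by positivity)
      (fun x _ => (hasDerivAt_id x).const_mul ((N / 2) ^ (2 * (m + 1)))) (fun x _ => hder x)
      (fun x hx => by
        rw [mul_one]
        exact pow_le_pow_left₀ (by positivity) (hRl x hx.1 hx.2.le) _)
    refine le_trans (le_of_eq ?_) this
    simp only [id]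
    field_simp
    ring
  set M := F.eval 1 - F.eval (-1) with hM
  have hMc : (N / 4) * (N / 2) ^ (2 * m) ≤ M := by
    have h1 := hmono (-1) 0 (by norm_num)
    have h2 := hmono (1 / N) 1 (by rw [div_le_one hNp]; linarith)
    linarith
  have hMp : 0 < M := lt_of_lt_of_le (by positivity) hMc
  have hbig : D / δ ≤ η / 2 * M := by
    have h1 : 2 / η * (D / δ) ≤ M := by
      calc 2 / η * (D / δ) ≤ 4 ^ m * (D / δ) := by gcongr
        _ = (1 / δ) * (2 * (1 / δ)) ^ (2 * m) := by
            rw [mul_pow, pow_mul 2 2 m, ← hD]; norm_num; ring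
        _ ≤ (N / 4) * (N / 2) ^ (2 * m) := by
            have ha : 1 / δ ≤ N / 4 := by linarith
            have hb : 2 * (1 / δ) ≤ N / 2 := by linarith
            exact mul_le_mul ha (pow_le_pow_left₀ (by positivity) hb _)
              (by positivity) (by positivity)
        _ ≤ M := hMc
    have h2 := mul_le_mul_of_nonneg_left h1 (by positivity : 0 ≤ η / 2)
    have e : η / 2 * (2 / η * (D / δ)) = D / δ := by field_simp
    rwa [e] at h2
  have hPe : ∀ x : ℝ, (Polynomial.C (1 / M) * (F - Polynomial.C (F.eval (-1)))).eval x
      = (F.eval x - F.eval (-1)) / M := by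
    intro x; simp; ring
  have hgen : ∀ x ∈ Set.Icc (-1 : ℝ) 1, 0 ≤ (F.eval x - F.eval (-1)) / M ∧
      (F.eval x - F.eval (-1)) / M ≤ 1 := by
    intro x hx
    have h1 := hmono _ _ hx.1
    have h2 := hmono _ _ hx.2
    exact ⟨div_nonneg (by linarith) hMp.le, by rw [div_le_one hMp]; linarith⟩
  refine ⟨Polynomial.C (1 / M) * (F - Polynomial.C (F.eval (-1))), ?_, ?_, ?_, ?_⟩
  · have h1 : (Polynomial.C (1 / M) * (F - Polynomial.C (F.eval (-1)))).natDegree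
        ≤ 2 * (m + 1) * (4 * j) + 1 := by
      refine (Polynomial.natDegree_C_mul_le _ _).trans ?_
      rw [Polynomial.natDegree_sub_C]
      refine hFd.trans ?_
      have := Polynomial.natDegree_pow_le (p := R) (n := 2 * (m + 1))
      have h2 := Nat.mul_le_mul_left (2 * (m + 1)) hRd
      omega
    refine h1.trans ?_
    have h3 : ((2 * (m + 1) * (4 * j) + 1 : ℕ) : ℝ) ≤ 100 * (1 / δ) * L := by
      push_cast
      have hL0 : 0 < L := by linarith
      have ha : (m : ℝ) + 1 ≤ 3 * (L / Real.log 2) := by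
        have : 1 ≤ L / Real.log 2 := by rw [le_div_iff₀ (by linarith)]; linarith
        linarith
      have hb : L / Real.log 2 ≤ L * (3 / 2) := by
        rw [div_le_iff₀ (by linarith)]
        nlinarith
      have hc : (m : ℝ) + 1 ≤ 9 / 2 * L := by linarith
      have hd : (j : ℝ) ≤ 2 * (1 / δ) := by linarith
      have he : ((m : ℝ) + 1) * j ≤ (9 / 2 * L) * (2 * (1 / δ)) := by gcongr
      have hg : L * 1 ≤ L * (1 / δ) := mul_le_mul_of_nonneg_left hδi hL0.le
      have hi : 0 < L * (1 / δ) := by positivity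
      calc 2 * ((m : ℝ) + 1) * (4 * j) + 1 = 8 * (((m : ℝ) + 1) * j) + 1 := by ring
        _ ≤ 8 * ((9 / 2 * L) * (2 * (1 / δ))) + 2 * (L * (1 / δ)) := by linarith
        _ = 74 * (L * (1 / δ)) := by ring
        _ ≤ 100 * (L * (1 / δ)) := by linarith
        _ = _ := by ring
    exact_mod_cast h3.trans (Nat.le_ceil _)
  · intro x hx
    rw [hPe]
    refine ⟨(hgen x ⟨hx.1, by linarith [hx.2]⟩).1, ?_⟩
    rw [div_le_iff₀ hMp]
    linarith [hmono _ _ hx.2]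
  · intro x hx
    rw [hPe]
    refine ⟨?_, (hgen x ⟨by linarith [hx.1], hx.2⟩).2⟩
    rw [le_div_iff₀ hMp]
    linarith [hmono _ _ hx.1]
  · intro x hx
    rw [hPe]
    exact hgen x hx
end

section
/- There exists a constant c > 0 such that for every δ ∈ (0, 1) and every η ∈ (0, 1) there is an odd real polynomial P of degree at most ⌈c · (1/δ) · log(2/η)⌉ satisfying |P(x)| ≤ 1 for all x ∈ [-1, 1] and |P(x) - sgn(x)| ≤ η for all x with δ ≤ |x| ≤ 1, where sgn(x) = 1 for x > 0 and sgn(x) = -1 for x < 0. -/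
open Polynomial in
/-- Odd monotone antiderivative of the square of an even polynomial. -/
theorem exists_antideriv_s1 (r : Polynomial ℝ) (hr : ∀ x, r.eval (-x) = r.eval x) :
    ∃ q : Polynomial ℝ, q.natDegree ≤ 2 * r.natDegree + 1 ∧
      (∀ x, HasDerivAt (fun y => q.eval y) ((r.eval x) ^ 2) x) ∧
      (∀ x, q.eval (-x) = - q.eval x) ∧ Monotone (fun x => q.eval x) := by
  set p := r ^ 2 with hp
  set q : Polynomial ℝ := ∑ i ∈ Finset.range (p.natDegree + 1), C (p.coeff i / (i + 1)) * X ^ (i + 1) with hq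
  have hdeg : q.natDegree ≤ 2 * r.natDegree + 1 := by
    apply natDegree_sum_le_of_forall_le
    intro i hi
    refine (natDegree_C_mul_X_pow_le _ _).trans ?_
    have h1 : p.natDegree ≤ 2 * r.natDegree := natDegree_pow_le
    have := Finset.mem_range.1 hi
    omega
  have hder : derivative q = p := by
    conv_rhs => rw [p.as_sum_range_C_mul_X_pow]
    rw [hq, derivative_sum]
    refine Finset.sum_congr rfl fun i _ => ?_
    rw [derivative_C_mul_X_pow]
    have : ((i : ℝ) + 1) ≠ 0 := by positivity
    simp only [Nat.add_sub_cancel]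
    congr 2
    push_cast
    field_simp
  have hD : ∀ x, HasDerivAt (fun y => q.eval y) ((r.eval x) ^ 2) x := by
    intro x
    have := q.hasDerivAt x
    rw [hder, hp, eval_pow] at this
    exact this
  have h0 : q.eval 0 = 0 := by
    rw [hq, eval_finsetSum]
    exact Finset.sum_eq_zero fun i _ => by simp
  refine ⟨q, hdeg, hD, ?_, ?_⟩
  · intro x
    have hd : ∀ x, HasDerivAt (fun y => q.eval (-y) + q.eval y) 0 x := by
      intro x
      have h1 := ((hD (-x)).comp x (hasDerivAt_neg x)).add (hD x)
      rw [hr] at h1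
      have e : (r.eval x) ^ 2 * (-1) + (r.eval x) ^ 2 = 0 := by ring
      rw [e] at h1
      exact h1
    have := is_const_of_deriv_eq_zero (fun x => (hd x).differentiableAt) (fun x => (hd x).deriv) x 0
    simp [h0] at this
    linarith
  · refine monotone_of_deriv_nonneg (fun x => (hD x).differentiableAt) fun x => ?_
    rw [(hD x).deriv]
    positivity

theorem lower_incr {f f' : ℝ → ℝ} (hD : ∀ x, HasDerivAt f (f' x) x) {a b C : ℝ} (hab : a ≤ b)
    (h : ∀ x ∈ Set.Ioo a b, C ≤ f' x) : C * (b - a) ≤ f b - f a := by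
  refine (convex_Icc a b).mul_sub_le_image_sub_of_le_deriv
    (fun x _ => (hD x).continuousAt.continuousWithinAt)
    (fun x _ => (hD x).differentiableAt.differentiableWithinAt) ?_ a (by simp [hab]) b (by simp [hab]) hab
  intro x hx
  rw [interior_Icc] at hx
  rw [(hD x).deriv]
  exact h x hx

theorem upper_incr {f f' : ℝ → ℝ} (hD : ∀ x, HasDerivAt f (f' x) x) {a b C : ℝ} (hab : a ≤ b)
    (h : ∀ x ∈ Set.Ioo a b, f' x ≤ C) : f b - f a ≤ C * (b - a) := by
  refine (convex_Icc a b).image_sub_le_mul_sub_of_deriv_le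
    (fun x _ => (hD x).continuousAt.continuousWithinAt)
    (fun x _ => (hD x).differentiableAt.differentiableWithinAt) ?_ a (by simp [hab]) b (by simp [hab]) hab
  intro x hx
  rw [interior_Icc] at hx
  rw [(hD x).deriv]
  exact h x hx

/-- Normalization of an odd monotone polynomial. -/
theorem normalize_poly (q : Polynomial ℝ) (hodd : ∀ x, q.eval (-x) = - q.eval x)
    (hmono : Monotone (fun x => q.eval x)) (h1 : 0 < q.eval 1) :
    ∃ Q : Polynomial ℝ, Q.natDegree ≤ q.natDegree ∧ (∀ x, Q.eval (-x) = - Q.eval x) ∧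
      (∀ x ∈ Set.Icc (-1 : ℝ) 1, |Q.eval x| ≤ 1) ∧ (∀ x, Q.eval x = q.eval x / q.eval 1) := by
  have he : ∀ x, (Polynomial.C (q.eval 1)⁻¹ * q).eval x = q.eval x / q.eval 1 := by
    intro x
    simp only [Polynomial.eval_mul, Polynomial.eval_C]
    ring
  refine ⟨Polynomial.C (q.eval 1)⁻¹ * q, Polynomial.natDegree_C_mul_le _ _, ?_, ?_, he⟩
  · intro x
    rw [he, he, hodd]
    ring
  · intro x hx
    rw [he, abs_div, abs_of_pos h1, div_le_one h1, abs_le]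
    have a := hmono hx.1
    have b := hmono hx.2
    simp only [hodd] at a b
    exact ⟨a, b⟩

theorem cheb_sin_sq (m : ℕ) (θ : ℝ) :
    ((Polynomial.Chebyshev.T ℝ ((2 * m + 1 : ℕ) : ℤ)).eval (Real.sin θ)) ^ 2
      = Real.sin ((2 * m + 1 : ℕ) * θ) ^ 2 := by
  rw [← Real.cos_pi_div_two_sub, Polynomial.Chebyshev.T_real_cos]
  have : (((2 * m + 1 : ℕ) : ℤ) : ℝ) * (Real.pi / 2 - θ)
      = (Real.pi / 2 - (2 * m + 1 : ℕ) * θ) + m * Real.pi := by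
    push_cast
    ring
  rw [this, Real.cos_add_nat_mul_pi, Real.cos_pi_div_two_sub, mul_pow, ← pow_mul, mul_comm m 2,
    pow_mul]
  simp

theorem step_one (δ : ℝ) (h0 : 0 < δ) (h1 : δ < 1) :
    ∃ Q : Polynomial ℝ, (Q.natDegree : ℝ) ≤ 10 / δ ∧ (∀ x, Q.eval (-x) = - Q.eval x) ∧
      (∀ x ∈ Set.Icc (-1 : ℝ) 1, |Q.eval x| ≤ 1) ∧
      (∀ x, δ ≤ x → x ≤ 1 → 1 / 3 ≤ Q.eval x) := by
  obtain ⟨m, hm⟩ : ∃ m : ℕ, m = ⌈1 / δ⌉₊ := ⟨_, rfl⟩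
  have hm1 : 1 / δ ≤ m := hm ▸ Nat.le_ceil _
  have hm2 : (m : ℝ) < 1 / δ + 1 := hm ▸ Nat.ceil_lt_add_one (by positivity)
  have hδ1 : 1 < 1 / δ := by rw [lt_div_iff₀ h0]; linarith
  obtain ⟨n, hn⟩ : ∃ n : ℕ, n = 2 * m + 1 := ⟨_, rfl⟩
  have hnR : (n : ℝ) = 2 * m + 1 := by rw [hn]; push_cast; ring
  have hnpos : (0 : ℝ) < n := by rw [hnR]; positivity
  have hodd : Odd (n : ℤ) := ⟨m, by rw [hn]; push_cast; ring⟩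
  set T := Polynomial.Chebyshev.T ℝ (n : ℤ) with hT
  have hT0 : T.coeff 0 = 0 := by
    rw [Polynomial.coeff_zero_eq_eval_zero]
    exact Polynomial.Chebyshev.T_eval_zero_of_odd _ hodd
  have hTneg : ∀ x, T.eval (-x) = - T.eval x := by
    intro x
    rw [hT, Polynomial.Chebyshev.T_eval_neg, Int.negOnePow_odd _ hodd]
    simp
  set r := T.divX with hrdef
  have hrT : ∀ x, r.eval x * x = T.eval x := by
    intro x
    conv_rhs => rw [← T.divX_mul_X_add, hT0]
    simp [hrdef]
  have hreven : ∀ x, r.eval (-x) = r.eval x := by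
    intro x
    by_cases hx : x = 0
    · simp [hx]
    · have a := hrT x
      have b := hrT (-x)
      rw [hTneg] at b
      have : r.eval (-x) * x = r.eval x * x := by linarith
      exact mul_right_cancel₀ hx this
  have hrdeg : r.natDegree = 2 * m := by
    rw [hrdef, Polynomial.natDegree_divX_eq_natDegree_tsub_one, hT,
      Polynomial.Chebyshev.natDegree_T]
    rw [Int.natAbs_natCast]
    omega
  obtain ⟨q, hqdeg, hD, hqodd, hmono⟩ := exists_antideriv_s1 r hreven
  have hq0 : q.eval 0 = 0 := by
    have := hqodd 0
    simp at this
    linarith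
  -- lower bound near zero
  have hlow : (n : ℝ) / 4 ≤ q.eval (1 / (n : ℝ)) := by
    have key := lower_incr hD (a := 0) (b := 1 / (n : ℝ)) (C := (n : ℝ) ^ 2 / 4) (by positivity) (by
      rintro x ⟨hx0, hx1⟩
      have hn1 : (1 : ℝ) ≤ n := by rw [hnR]; linarith [hδ1]
      have hx1' : x < 1 := hx1.trans_le (by rw [div_le_one hnpos]; exact hn1)
      have hs : Real.sin (Real.arcsin x) = x := Real.sin_arcsin (by linarith) hx1'.le
      set θ := Real.arcsin x with hθ
      have hθ0 : 0 < θ := Real.arcsin_pos.2 hx0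
      have hθ2 : θ ≤ Real.pi / 2 := Real.arcsin_le_pi_div_two x
      have hb := Real.mul_le_sin hθ0.le hθ2
      rw [hs] at hb
      have hpi := Real.pi_pos
      have hnx : n * x < 1 := by
        rw [lt_div_iff₀ hnpos] at hx1
        linarith
      have hnθ : n * θ ≤ Real.pi / 2 := by
        have e : θ ≤ Real.pi / 2 * x := by
          have := mul_le_mul_of_nonneg_left hb (show 0 ≤ Real.pi / 2 by positivity)
          calc θ = Real.pi / 2 * (2 / Real.pi * θ) := by field_simp
            _ ≤ _ := this
        nlinarith
      have hxθ : x ≤ θ := by rw [← hs]; exact Real.sin_le hθ0.le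
      have hS := Real.mul_le_sin (show 0 ≤ n * θ by positivity) hnθ
      have hpi4 : 1 / 2 ≤ 2 / Real.pi := by
        rw [div_le_div_iff₀ (by norm_num) hpi]
        linarith [Real.pi_le_four]
      have hS2 : n / 2 * x ≤ Real.sin (n * θ) := by
        refine le_trans ?_ hS
        calc n / 2 * x = 1 / 2 * (n * x) := by ring
          _ ≤ 2 / Real.pi * (n * θ) := by gcongr
      have hsq : (T.eval x) ^ 2 = Real.sin (n * θ) ^ 2 := by
        have := cheb_sin_sq m θ
        rw [← hn, hs] at this
        exact this
      have h3 : (n / 2 * x) ^ 2 ≤ (r.eval x * x) ^ 2 := by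
        rw [hrT, hsq]
        gcongr
      have h4 : (n : ℝ) ^ 2 / 4 * x ^ 2 ≤ (r.eval x) ^ 2 * x ^ 2 := by
        calc (n : ℝ) ^ 2 / 4 * x ^ 2 = (n / 2 * x) ^ 2 := by ring
          _ ≤ _ := h3
          _ = _ := by ring
      exact le_of_mul_le_mul_right h4 (by positivity))
    rw [hq0] at key
    calc (n : ℝ) / 4 = (n : ℝ) ^ 2 / 4 * (1 / n - 0) := by field_simp; ring
      _ ≤ _ := key
      _ = _ := by ring
  -- upper bound away from zero
  have hup : q.eval 1 + 1 ≤ q.eval δ + 1 / δ := by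
    have hanti : AntitoneOn (fun x => q.eval x + x⁻¹) (Set.Icc δ 1) := by
      have hd : ∀ x ∈ Set.Icc δ 1, HasDerivAt (fun x => q.eval x + x⁻¹)
          ((r.eval x) ^ 2 + -(x ^ 2)⁻¹) x := by
        intro x hx
        exact (hD x).add (hasDerivAt_inv (by linarith [hx.1]))
      refine antitoneOn_of_deriv_nonpos (convex_Icc _ _)
        (fun x hx => (hd x hx).continuousAt.continuousWithinAt)
        (fun x hx => (hd x (interior_subset hx)).differentiableAt.differentiableWithinAt) ?_
      intro x hx
      have hx' := interior_subset hx
      rw [(hd x hx').deriv]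
      have hxpos : 0 < x := by linarith [hx'.1]
      have hTle : |T.eval x| ≤ 1 := Polynomial.Chebyshev.abs_eval_T_real_le_one _
        (by rw [abs_of_pos hxpos]; exact hx'.2)
      have h5 : (r.eval x * x) ^ 2 ≤ 1 := by
        rw [hrT]
        exact (sq_le_one_iff_abs_le_one _).2 hTle
      have : (r.eval x) ^ 2 ≤ (x ^ 2)⁻¹ := by
        rw [← one_div, le_div_iff₀ (by positivity)]
        linarith [mul_pow (r.eval x) x 2]
      linarith
    have := hanti (Set.left_mem_Icc.2 h1.le) (Set.right_mem_Icc.2 h1.le) h1.le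
    simp only [inv_one] at this
    rw [one_div]
    exact this
  have hnδ : 1 / (n : ℝ) ≤ δ := by
    rw [div_le_iff₀ hnpos]
    have := (div_le_iff₀ h0).1 hm1
    rw [hnR]
    nlinarith
  have hqδ : (n : ℝ) / 4 ≤ q.eval δ := hlow.trans (hmono hnδ)
  have hq1 : 0 < q.eval 1 := by
    have := hmono h1.le
    simp only at this
    linarith [div_pos hnpos (show (0 : ℝ) < 4 by norm_num)]
  obtain ⟨Q, hQdeg, hQodd, hQb, hQe⟩ := normalize_poly q hqodd hmono hq1
  refine ⟨Q, ?_, hQodd, hQb, ?_⟩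
  · have : Q.natDegree ≤ 4 * m + 1 := by omega
    have h6 : (Q.natDegree : ℝ) ≤ 4 * m + 1 := by exact_mod_cast this
    have : 10 / δ = 10 * (1 / δ) := by ring
    rw [this]
    linarith
  · intro x hx _
    rw [hQe, div_le_div_iff₀ (by norm_num) hq1]
    have := hmono hx
    simp only at this
    linarith

theorem step_two (η : ℝ) (h0 : 0 < η) (h1 : η < 1) :
    ∃ A : Polynomial ℝ, (A.natDegree : ℝ) ≤ 90 * Real.log (2 / η) ∧
      (∀ x, A.eval (-x) = - A.eval x) ∧
      (∀ x ∈ Set.Icc (-1 : ℝ) 1, |A.eval x| ≤ 1) ∧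
      (∀ x, 1 / 3 ≤ x → x ≤ 1 → 1 - η ≤ A.eval x) := by
  have hL : Real.log (2 / η) = Real.log 2 - Real.log η := Real.log_div (by norm_num) h0.ne'
  have hlogη : Real.log η < 0 := Real.log_neg h0 h1
  have hlog2 := Real.log_two_gt_d9
  set L := Real.log (2 / η) with hLdef
  have hL1 : 0.69 < L := by linarith
  obtain ⟨k, hk⟩ : ∃ k : ℕ, k = ⌈20 * L⌉₊ := ⟨_, rfl⟩
  have hk1 : 20 * L ≤ k := hk ▸ Nat.le_ceil _
  have hk2 : (k : ℝ) < 20 * L + 1 := hk ▸ Nat.ceil_lt_add_one (by linarith)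
  set r : Polynomial ℝ := (1 - Polynomial.X ^ 2) ^ k with hr
  have hre : ∀ x, r.eval x = (1 - x ^ 2) ^ k := by intro x; simp [hr]
  have hrdeg : r.natDegree ≤ 2 * k := by
    have h : (1 - Polynomial.X ^ 2 : Polynomial ℝ).natDegree ≤ 2 := by compute_degree
    calc r.natDegree ≤ k * (1 - Polynomial.X ^ 2 : Polynomial ℝ).natDegree :=
          Polynomial.natDegree_pow_le
      _ ≤ k * 2 := by gcongr
      _ = _ := by ring
  obtain ⟨q, hqdeg, hD, hqodd, hmono⟩ := exists_antideriv_s1 r (by intro x; rw [hre, hre]; ring)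
  have hq0 : q.eval 0 = 0 := by
    have := hqodd 0
    simp at this
    linarith
  have hlow : ((15 / 16 : ℝ) ^ k) ^ 2 / 4 ≤ q.eval 1 := by
    have key := lower_incr hD (a := 0) (b := 1 / 4) (C := ((15 / 16 : ℝ) ^ k) ^ 2) (by norm_num) (by
      rintro x ⟨hx0, hx1⟩
      rw [hre]
      have : (15 / 16 : ℝ) ≤ 1 - x ^ 2 := by nlinarith
      gcongr)
    have := hmono (show (1 / 4 : ℝ) ≤ 1 by norm_num)
    simp only at this
    rw [hq0] at key
    linarith
  have hq1 : 0 < q.eval 1 := lt_of_lt_of_le (by positivity) hlow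
  have hsmall : 4 * (9 / 10 : ℝ) ^ k ≤ η := by
    have e1 : (9 / 10 : ℝ) ^ k ≤ Real.exp (-(k / 10)) := by
      calc (9 / 10 : ℝ) ^ k ≤ (Real.exp (-(1 / 10))) ^ k := by
            gcongr
            linarith [Real.add_one_le_exp (-(1 / 10) : ℝ)]
        _ = _ := by rw [← Real.exp_nat_mul]; congr 1; ring
    have e2 : Real.exp (-(k / 10)) ≤ Real.exp (Real.log η - 2 * Real.log 2) := by
      apply Real.exp_le_exp.2
      linarith
    have e3 : Real.exp (Real.log η - 2 * Real.log 2) = η / 4 := by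
      rw [Real.exp_sub, Real.exp_log h0, two_mul, Real.exp_add, Real.exp_log (by norm_num)]
      norm_num
    linarith
  obtain ⟨A, hAdeg, hAodd, hAb, hAe⟩ := normalize_poly q hqodd hmono hq1
  refine ⟨A, ?_, hAodd, hAb, ?_⟩
  · have : A.natDegree ≤ 4 * k + 1 := by omega
    have h6 : (A.natDegree : ℝ) ≤ 4 * k + 1 := by exact_mod_cast this
    linarith
  · intro x hx hx1
    have key := upper_incr hD (a := x) (b := 1) (C := ((8 / 9 : ℝ) ^ k) ^ 2) hx1 (by
      rintro y ⟨hy0, hy1⟩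
      rw [hre]
      have : 1 - y ^ 2 ≤ (8 / 9 : ℝ) := by nlinarith
      have : 0 ≤ 1 - y ^ 2 := by nlinarith
      gcongr)
    have key2 : q.eval 1 - q.eval x ≤ ((8 / 9 : ℝ) ^ k) ^ 2 := by
      refine key.trans (mul_le_of_le_one_right (by positivity) (by linarith))
    have hcmp : ((8 / 9 : ℝ) ^ k) ^ 2 ≤ (9 / 10) ^ k * ((15 / 16 : ℝ) ^ k) ^ 2 := by
      rw [← pow_mul, ← pow_mul, mul_comm k 2, pow_mul, pow_mul, ← mul_pow]
      gcongr
      norm_num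
    have : η * (((15 / 16 : ℝ) ^ k) ^ 2 / 4) ≤ η * q.eval 1 := by gcongr
    have h7 : (4 * (9 / 10 : ℝ) ^ k) * (((15 / 16 : ℝ) ^ k) ^ 2 / 4)
        ≤ η * (((15 / 16 : ℝ) ^ k) ^ 2 / 4) := by gcongr
    rw [hAe, le_div_iff₀ hq1]
    linarith

/-- Polynomial approximation of the sign function (Gilyén et al., Lemma 14):
for every `δ, η ∈ (0,1)` there is an odd polynomial of degree
`O((1/δ) log(2/η))`, bounded by `1` on `[-1, 1]`, that is `η`-close to the
sign function on `{x : δ ≤ |x| ≤ 1}`. -/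
theorem sign_function_poly_approx :
    ∃ c : ℝ, 0 < c ∧
      ∀ δ η : ℝ, δ ∈ Set.Ioo (0 : ℝ) 1 → η ∈ Set.Ioo (0 : ℝ) 1 →
        ∃ P : Polynomial ℝ,
          P.natDegree ≤ ⌈c * (1 / δ) * Real.log (2 / η)⌉₊ ∧
          (∀ x : ℝ, P.eval (-x) = -P.eval x) ∧
          (∀ x ∈ Set.Icc (-1 : ℝ) 1, |P.eval x| ≤ 1) ∧
          (∀ x : ℝ, δ ≤ |x| → |x| ≤ 1 →
            |P.eval x - (if 0 < x then (1 : ℝ) else -1)| ≤ η) := by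
  refine ⟨900, by norm_num, ?_⟩
  intro δ η hδ hη
  obtain ⟨Q, hQdeg, hQodd, hQb, hQl⟩ := step_one δ hδ.1 hδ.2
  obtain ⟨A, hAdeg, hAodd, hAb, hAl⟩ := step_two η hη.1 hη.2
  have hodd : ∀ x : ℝ, (A.comp Q).eval (-x) = -(A.comp Q).eval x := by
    intro x
    rw [Polynomial.eval_comp, Polynomial.eval_comp, hQodd, hAodd]
  have hb : ∀ x ∈ Set.Icc (-1 : ℝ) 1, |(A.comp Q).eval x| ≤ 1 := by
    intro x hx
    rw [Polynomial.eval_comp]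
    exact hAb _ (abs_le.1 (hQb x hx))
  have hpos : ∀ x : ℝ, δ ≤ x → x ≤ 1 → |(A.comp Q).eval x - 1| ≤ η := by
    intro x hx hx1
    have hx' : x ∈ Set.Icc (-1 : ℝ) 1 := ⟨by linarith [hδ.1], hx1⟩
    have a := (abs_le.1 (hb x hx')).2
    have b := hAl _ (hQl x hx hx1) (abs_le.1 (hQb x hx')).2
    rw [← Polynomial.eval_comp] at b
    rw [abs_le]
    constructor <;> linarith [hη.1]
  refine ⟨A.comp Q, ?_, hodd, hb, ?_⟩
  · have h : ((A.comp Q).natDegree : ℝ) ≤ 900 * (1 / δ) * Real.log (2 / η) := by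
      have h10 : 0 ≤ 10 / δ := div_nonneg (by norm_num) hδ.1.le
      calc ((A.comp Q).natDegree : ℝ) = A.natDegree * Q.natDegree := by
            rw [Polynomial.natDegree_comp]; push_cast; ring
        _ ≤ A.natDegree * (10 / δ) := by gcongr
        _ ≤ (90 * Real.log (2 / η)) * (10 / δ) := by gcongr
        _ = _ := by ring
    exact_mod_cast h.trans (Nat.le_ceil _)
  · intro x hx hx1
    split_ifs with h
    · rw [abs_of_pos h] at hx hx1
      exact hpos x hx hx1
    · rw [abs_of_nonpos (not_lt.1 h)] at hx hx1
      have := hpos (-x) hx hx1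
      rw [hodd] at this
      rw [← abs_neg]
      convert this using 2
      ring
end
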